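/- Cut-free completeness of RT: if a hypersequent H is not provable in cut-free RT (cut-free RK extended with the external contraction rule EC), then there is a Kripke model with reflexive accessibility relation that is a counter-example to H; equivalently, every hypersequent valid over the class of reflexive frames is provable in RT without the cut rule. -/

import Mathlib

/-- Modal formulas: atoms, negation, conjunction, box. -/
inductive MF : Type
  | atom : ℕ → MF
  | neg : MF → MF
  | conj : MF → MF → MF
  | box : MF → MF

/-- A sequent: a pair of finite multisets of modal formulas. -/
structure Seqt : Type where
  ant : Multiset MF
  suc : Multiset MF

/-- The empty sequent. -/
def Seqt.empty : Seqt := ⟨0, 0⟩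

/-- A hypersequent: a (nonempty, enforced in theorems) sequence of sequents. -/
abbrev Hyperseq := List Seqt

/-- A Kripke model. -/
structure KModel : Type 1 where
  W : Type
  R : W → W → Prop
  V : ℕ → W → Prop

/-- Satisfaction of a modal formula at a world. -/
def KModel.sat (M : KModel) : M.W → MF → Prop
  | w, .atom n => M.V n w
  | w, .neg φ => ¬ M.sat w φ
  | w, .conj φ ψ => M.sat w φ ∧ M.sat w ψ
  | w, .box φ => ∀ v, M.R w v → M.sat v φ

/-- `M` is a countermodel to sequent `S` at world `w`. -/
def Countermodel (M : KModel) (w : M.W) (S : Seqt) : Prop :=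
  (∀ φ ∈ S.ant, M.sat w φ) ∧ (∀ φ ∈ S.suc, ¬ M.sat w φ)

/-- `M` is a counter-example to hypersequent `H`: there is a branch of worlds
(consecutive worlds related by `R`) falsifying the components pointwise. -/
def CounterExample (M : KModel) (H : Hyperseq) : Prop :=
  ∃ ws : List M.W, List.Chain' M.R ws ∧
    List.Forall₂ (fun S w => Countermodel M w S) H ws

/-- Which optional rules are present in a calculus (RK rules are always present). -/
structure RuleSet : Type where
  cut : Bool := false
  ec : Bool := false
  ew : Bool := false
  ee : Bool := false
  drop : Bool := false
  sym : Bool := false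

/-- Derivability in a relational hypersequent calculus: the rules of RK
(axioms, internal weakening/contraction, EWL/EWR, rules for ¬, ∧, □),
plus cut and the external structural rules EC, EW, EE, Drop, Sym when enabled. -/
inductive Deriv (ρ : RuleSet) : Hyperseq → Prop
  | ax (φ : MF) : Deriv ρ [⟨{φ}, {φ}⟩]
  | wl (G H : Hyperseq) (Γ Δ : Multiset MF) (φ : MF) :
      Deriv ρ (G ++ ⟨Γ, Δ⟩ :: H) → Deriv ρ (G ++ ⟨φ ::ₘ Γ, Δ⟩ :: H)
  | wr (G H : Hyperseq) (Γ Δ : Multiset MF) (φ : MF) :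
      Deriv ρ (G ++ ⟨Γ, Δ⟩ :: H) → Deriv ρ (G ++ ⟨Γ, φ ::ₘ Δ⟩ :: H)
  | cl (G H : Hyperseq) (Γ Δ : Multiset MF) (φ : MF) :
      Deriv ρ (G ++ ⟨φ ::ₘ φ ::ₘ Γ, Δ⟩ :: H) → Deriv ρ (G ++ ⟨φ ::ₘ Γ, Δ⟩ :: H)
  | cr (G H : Hyperseq) (Γ Δ : Multiset MF) (φ : MF) :
      Deriv ρ (G ++ ⟨Γ, φ ::ₘ φ ::ₘ Δ⟩ :: H) → Deriv ρ (G ++ ⟨Γ, φ ::ₘ Δ⟩ :: H)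
  | cut (hρ : ρ.cut = true) (G H : Hyperseq) (Γ Δ Λ Θ : Multiset MF) (φ : MF) :
      Deriv ρ (G ++ ⟨Γ, φ ::ₘ Δ⟩ :: H) → Deriv ρ (G ++ ⟨φ ::ₘ Λ, Θ⟩ :: H) →
      Deriv ρ (G ++ ⟨Γ + Λ, Δ + Θ⟩ :: H)
  | ewr (G : Hyperseq) : Deriv ρ G → Deriv ρ (G ++ [Seqt.empty])
  | ewl (G : Hyperseq) : Deriv ρ G → Deriv ρ (Seqt.empty :: G)
  | negL (G H : Hyperseq) (Γ Δ : Multiset MF) (φ : MF) :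
      Deriv ρ (G ++ ⟨Γ, φ ::ₘ Δ⟩ :: H) → Deriv ρ (G ++ ⟨.neg φ ::ₘ Γ, Δ⟩ :: H)
  | negR (G H : Hyperseq) (Γ Δ : Multiset MF) (φ : MF) :
      Deriv ρ (G ++ ⟨φ ::ₘ Γ, Δ⟩ :: H) → Deriv ρ (G ++ ⟨Γ, .neg φ ::ₘ Δ⟩ :: H)
  | andL1 (G H : Hyperseq) (Γ Δ : Multiset MF) (φ ψ : MF) :
      Deriv ρ (G ++ ⟨φ ::ₘ Γ, Δ⟩ :: H) → Deriv ρ (G ++ ⟨.conj φ ψ ::ₘ Γ, Δ⟩ :: H)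
  | andL2 (G H : Hyperseq) (Γ Δ : Multiset MF) (φ ψ : MF) :
      Deriv ρ (G ++ ⟨ψ ::ₘ Γ, Δ⟩ :: H) → Deriv ρ (G ++ ⟨.conj φ ψ ::ₘ Γ, Δ⟩ :: H)
  | andR (G H : Hyperseq) (Γ Δ : Multiset MF) (φ ψ : MF) :
      Deriv ρ (G ++ ⟨Γ, φ ::ₘ Δ⟩ :: H) → Deriv ρ (G ++ ⟨Γ, ψ ::ₘ Δ⟩ :: H) →
      Deriv ρ (G ++ ⟨Γ, .conj φ ψ ::ₘ Δ⟩ :: H)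
  | boxL (G H : Hyperseq) (Γ Δ Λ Θ : Multiset MF) (φ : MF) :
      Deriv ρ (G ++ ⟨Γ, Δ⟩ :: ⟨φ ::ₘ Λ, Θ⟩ :: H) →
      Deriv ρ (G ++ ⟨.box φ ::ₘ Γ, Δ⟩ :: ⟨Λ, Θ⟩ :: H)
  | boxR (G : Hyperseq) (Γ Δ : Multiset MF) (φ : MF) :
      Deriv ρ (G ++ [⟨Γ, Δ⟩, ⟨0, {φ}⟩]) → Deriv ρ (G ++ [⟨Γ, .box φ ::ₘ Δ⟩])
  | ec (hρ : ρ.ec = true) (G H : Hyperseq) (S : Seqt) :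
      Deriv ρ (G ++ S :: S :: H) → Deriv ρ (G ++ S :: H)
  | ew (hρ : ρ.ew = true) (G H : Hyperseq) :
      Deriv ρ (G ++ H) → Deriv ρ (G ++ Seqt.empty :: H)
  | ee (hρ : ρ.ee = true) (G H : Hyperseq) (S S' : Seqt) :
      Deriv ρ (G ++ S :: S' :: H) → Deriv ρ (G ++ S' :: S :: H)
  | drop (hρ : ρ.drop = true) (G : Hyperseq) :
      Deriv ρ (G ++ [Seqt.empty]) → Deriv ρ G
  | symm (hρ : ρ.sym = true) (G : Hyperseq) : Deriv ρ G → Deriv ρ G.reverse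

/-- Cut-free RT: cut-free RK plus the external contraction rule EC. -/
def cfRT : RuleSet := { ec := true }

/-- Inclusion of sequents that ignores multiplicities. -/
def Seqt.Incl (S S' : Seqt) : Prop := S.ant ⊆ S'.ant ∧ S.suc ⊆ S'.suc

/-- Formulas signed by the side of the sequent they occur on (`true` for the antecedent). -/
abbrev SignedMF := Bool × MF

/-- All formulas of the finite sequent `S` occur, with the right sign, in `T`. -/
def Seqt.Within (S : Seqt) (T : Set SignedMF) : Prop :=
  (∀ φ ∈ S.ant, (true, φ) ∈ T) ∧ (∀ φ ∈ S.suc, (false, φ) ∈ T)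

/-- Add a signed formula to a sequent. -/
def Seqt.add : SignedMF → Seqt → Seqt
  | (true, φ), S => ⟨φ ::ₘ S.ant, S.suc⟩
  | (false, φ), S => ⟨S.ant, φ ::ₘ S.suc⟩

/-- A sequence of possibly infinite sequents is consistent if no componentwise finite part of it
is derivable in cut-free RT. -/
def Consistent (Ts : List (Set SignedMF)) : Prop :=
  ∀ L : Hyperseq, List.Forall₂ Seqt.Within L Ts → ¬ Deriv cfRT L

theorem Seqt.within_empty (T : Set SignedMF) : Seqt.empty.Within T := by
  simp [Seqt.Within, Seqt.empty]

theorem Seqt.Within.add {S : Seqt} {T : Set SignedMF} {x : SignedMF} (h : S.Within T)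
    (hx : x ∈ T) : (S.add x).Within T := by
  obtain ⟨b, φ⟩ := x
  cases b <;> simp only [Seqt.Within, Seqt.add, Multiset.mem_cons, forall_eq_or_imp]
  · exact ⟨h.1, hx, h.2⟩
  · exact ⟨⟨hx, h.1⟩, h.2⟩

theorem Seqt.Incl.add {S S' : Seqt} (h : S.Incl S') (x : SignedMF) :
    (S.add x).Incl (S'.add x) := by
  obtain ⟨b, φ⟩ := x
  cases b
  · exact ⟨h.1, Multiset.cons_subset_cons h.2⟩
  · exact ⟨Multiset.cons_subset_cons h.1, h.2⟩

theorem Seqt.Within.exists_add {S : Seqt} {T : Set SignedMF} {x : SignedMF}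
    (h : S.Within (insert x T)) : ∃ S' : Seqt, S'.Within T ∧ S.Incl (S'.add x) := by
  classical
  refine ⟨⟨S.ant.filter fun φ => (true, φ) ∈ T, S.suc.filter fun φ => (false, φ) ∈ T⟩,
    ⟨fun φ hφ => (Multiset.mem_filter.1 hφ).2, fun φ hφ => (Multiset.mem_filter.1 hφ).2⟩, ?_⟩
  obtain ⟨b, φ⟩ := x
  constructor
  · intro ψ hψ
    have := h.1 ψ hψ
    cases b <;> simp_all [Seqt.add]
  · intro ψ hψ
    have := h.2 ψ hψ
    cases b <;> simp_all [Seqt.add]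

section Structural

variable {ρ : RuleSet}

theorem Deriv.weaken {G H : Hyperseq} {Γ Δ : Multiset MF} (Γ' Δ' : Multiset MF)
    (h : Deriv ρ (G ++ ⟨Γ, Δ⟩ :: H)) : Deriv ρ (G ++ ⟨Γ' + Γ, Δ' + Δ⟩ :: H) := by
  induction Γ' using Multiset.induction_on with
  | empty =>
    induction Δ' using Multiset.induction_on with
    | empty => simpa using h
    | cons φ Δ' ih => rw [Multiset.cons_add]; exact .wr _ _ _ _ _ ih
  | cons φ Γ' ih => rw [Multiset.cons_add]; exact .wl _ _ _ _ _ ih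

theorem Deriv.contract_ant {G H : Hyperseq} {Γ Γ' Δ : Multiset MF} (hΓ : Γ' ⊆ Γ)
    (h : Deriv ρ (G ++ ⟨Γ' + Γ, Δ⟩ :: H)) : Deriv ρ (G ++ ⟨Γ, Δ⟩ :: H) := by
  induction Γ' using Multiset.induction_on with
  | empty => simpa using h
  | cons φ Γ' ih =>
    obtain ⟨hφ, hΓ⟩ := Multiset.cons_subset.1 hΓ
    refine ih hΓ ?_
    obtain ⟨Γ₀, rfl⟩ := Multiset.exists_cons_of_mem hφ
    rw [Multiset.add_cons]
    refine .cl _ _ _ _ _ ?_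
    rwa [Multiset.cons_add, Multiset.add_cons] at h

theorem Deriv.contract_suc {G H : Hyperseq} {Γ Δ Δ' : Multiset MF} (hΔ : Δ' ⊆ Δ)
    (h : Deriv ρ (G ++ ⟨Γ, Δ' + Δ⟩ :: H)) : Deriv ρ (G ++ ⟨Γ, Δ⟩ :: H) := by
  induction Δ' using Multiset.induction_on with
  | empty => simpa using h
  | cons φ Δ' ih =>
    obtain ⟨hφ, hΔ⟩ := Multiset.cons_subset.1 hΔ
    refine ih hΔ ?_
    obtain ⟨Δ₀, rfl⟩ := Multiset.exists_cons_of_mem hφ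
    rw [Multiset.add_cons]
    refine .cr _ _ _ _ _ ?_
    rwa [Multiset.cons_add, Multiset.add_cons] at h

theorem Deriv.incl {G H : Hyperseq} {S S' : Seqt} (hS : S.Incl S')
    (h : Deriv ρ (G ++ S :: H)) : Deriv ρ (G ++ S' :: H) := by
  refine .contract_ant hS.1 (.contract_suc hS.2 ?_)
  rw [add_comm S.ant, add_comm S.suc]
  exact .weaken _ _ h

theorem Deriv.forall₂_incl {L L' : Hyperseq} (hL : List.Forall₂ Seqt.Incl L L') :
    ∀ {G : Hyperseq}, Deriv ρ (G ++ L) → Deriv ρ (G ++ L') := by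
  induction hL with
  | nil => exact id
  | @cons S S' L L' hS _ ih =>
    intro G h
    have := ih (G := G ++ [S']) (by simpa using h.incl hS)
    simpa using this

theorem Deriv.append_empty {G : Hyperseq} (h : Deriv ρ G) (n : ℕ) :
    Deriv ρ (G ++ List.replicate n Seqt.empty) := by
  induction n with
  | zero => simpa using h
  | succ n ih =>
    rw [List.replicate_succ', ← List.append_assoc]
    exact .ewr _ ih

theorem Deriv.boxL_map {S : Seqt} {Γ Λ Δ : Multiset MF} {H : Hyperseq} :
    Deriv ρ (S :: ⟨Γ + Λ, Δ⟩ :: H) →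
      Deriv ρ (⟨Γ.map .box + S.ant, S.suc⟩ :: ⟨Λ, Δ⟩ :: H) := by
  induction Γ using Multiset.induction_on generalizing Λ with
  | empty => intro h; simpa using h
  | cons φ Γ ih =>
    intro h
    rw [Multiset.cons_add, ← Multiset.add_cons] at h
    rw [Multiset.map_cons, Multiset.cons_add]
    exact .boxL [] H _ _ _ _ _ (ih h)

theorem Deriv.reflexivity (hρ : ρ.ec = true) {Γ Δ : Multiset MF} {φ : MF} {H : Hyperseq}
    (h : Deriv ρ (⟨φ ::ₘ Γ, Δ⟩ :: H)) : Deriv ρ (⟨.box φ ::ₘ Γ, Δ⟩ :: H) := by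
  refine .ec hρ [] H _ ?_
  refine .wl [⟨.box φ ::ₘ Γ, Δ⟩] H _ _ _ (.boxL [] H _ _ _ _ _ ?_)
  exact .incl (G := []) (S := Seqt.empty) (by simp [Seqt.Incl, Seqt.empty]) (.ewl _ h)

end Structural

theorem exists_common_extension {R R' : Hyperseq} {Ts : List (Set SignedMF)}
    (h : List.Forall₂ Seqt.Within R Ts) (h' : List.Forall₂ Seqt.Within R' Ts) :
    ∃ Q : Hyperseq, List.Forall₂ Seqt.Within Q Ts ∧
      List.Forall₂ Seqt.Incl R Q ∧ List.Forall₂ Seqt.Incl R' Q := by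
  induction h generalizing R' with
  | nil => cases h'; exact ⟨[], .nil, .nil, .nil⟩
  | @cons S T R Ts hS _ ih =>
    cases h' with
    | @cons S' _ R' _ hS' hR' =>
      obtain ⟨Q, hQ, h1, h2⟩ := ih hR'
      refine ⟨⟨S.ant + S'.ant, S.suc + S'.suc⟩ :: Q, .cons ?_ hQ, .cons ?_ h1, .cons ?_ h2⟩
      · simp only [Seqt.Within, Multiset.mem_add]
        exact ⟨fun φ hφ => hφ.elim (hS.1 φ) (hS'.1 φ), fun φ hφ => hφ.elim (hS.2 φ) (hS'.2 φ)⟩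
      · constructor <;> intro φ hφ <;> simp [hφ]
      · constructor <;> intro φ hφ <;> simp [hφ]

section Consistency

variable {T U : Set SignedMF} {Ts : List (Set SignedMF)}

theorem Consistent.tail (h : Consistent (T :: Ts)) : Consistent Ts :=
  fun _ hL hd => h _ (.cons (Seqt.within_empty T) hL) (.ewl _ hd)

theorem forall₂_within_replicate_empty (Ts : List (Set SignedMF)) :
    List.Forall₂ Seqt.Within (List.replicate Ts.length Seqt.empty) Ts := by
  induction Ts with
  | nil => exact .nil
  | cons T Ts ih => exact .cons (Seqt.within_empty T) ih

theorem Consistent.head (h : Consistent (T :: Ts)) : Consistent [T] := by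
  rintro _ (_ | ⟨hS, _ | _⟩) hd
  exact h _ (.cons hS (forall₂_within_replicate_empty Ts)) (hd.append_empty Ts.length)

/-- The formulas that must hold at every successor of a world described by `T`. -/
def boxed (T : Set SignedMF) : Set SignedMF := {x | x.1 = true ∧ (true, .box x.2) ∈ T}

theorem Consistent.union_boxed (h : Consistent (T :: U :: Ts)) :
    Consistent (T :: (U ∪ boxed T) :: Ts) := by
  classical
  rintro _ (_ | @⟨S, _, _, _, hS, _ | @⟨S', _, R, _, hS', hR⟩⟩) hd
  let p : MF → Prop := fun φ => (true, .box φ) ∈ T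
  rw [show S' = ⟨S'.ant.filter p + S'.ant.filter fun φ => ¬ p φ, S'.suc⟩ by
    rw [Multiset.filter_add_not]] at hd
  refine absurd hd.boxL_map
    (h _ (.cons ⟨fun φ hφ => ?_, hS.2⟩ (.cons ⟨fun φ hφ => ?_, fun φ hφ => ?_⟩ hR)))
  · rcases Multiset.mem_add.1 hφ with hφ | hφ
    · obtain ⟨ψ, hψ, rfl⟩ := Multiset.mem_map.1 hφ
      exact (Multiset.mem_filter.1 hψ).2
    · exact hS.1 φ hφ
  · obtain ⟨hφ, hp⟩ := Multiset.mem_filter.1 hφ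
    exact (hS'.1 φ hφ).resolve_right fun hb => hp hb.2
  · exact (hS'.2 φ hφ).resolve_right fun hb => Bool.false_ne_true hb.1

theorem Consistent.boxR {φ : MF} (h : Consistent [T]) (hφ : (false, .box φ) ∈ T) :
    Consistent [T, {(false, φ)}] := by
  rintro _ (_ | @⟨S, _, _, _, hS, _ | @⟨S', _, _, _, hS', _ | _⟩⟩) hd
  refine h [S.add (false, .box φ)] (.cons (hS.add hφ) .nil) (.boxR [] _ _ _ ?_)
  refine .incl (G := [S]) ⟨fun ψ hψ => ?_, fun ψ hψ => ?_⟩ hd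
  · simpa using hS'.1 ψ hψ
  · simpa using hS'.2 ψ hψ

theorem Consistent.exists_maximal (h : Consistent (T :: Ts)) :
    ∃ W, T ⊆ W ∧ Maximal (fun W => Consistent (W :: Ts)) W := by
  refine zorn_subset_nonempty {W | Consistent (W :: Ts)} ?_ T h
  intro c hc hchain hne
  refine ⟨⋃₀ c, ?_, fun s hs => Set.subset_sUnion_of_mem hs⟩
  rintro _ (_ | @⟨S, _, R, _, hS, hR⟩) hd
  classical
  let F : Finset SignedMF :=
    S.ant.toFinset.image (Prod.mk true) ∪ S.suc.toFinset.image (Prod.mk false)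
  have hF : (F : Set SignedMF) ⊆ ⋃₀ c := by
    intro x hx
    simp only [F, Finset.coe_union, Finset.coe_image, Set.mem_union, Set.mem_image,
      Finset.mem_coe, Multiset.mem_toFinset] at hx
    rcases hx with ⟨φ, hφ, rfl⟩ | ⟨φ, hφ, rfl⟩
    · exact hS.1 φ hφ
    · exact hS.2 φ hφ
  obtain ⟨W, hW, hFW⟩ := DirectedOn.exists_mem_subset_of_finite_of_subset_sUnion hne
    hchain.directedOn F.finite_toSet hF
  refine hc hW _ (.cons ⟨fun φ hφ => hFW ?_, fun φ hφ => hFW ?_⟩ hR) hd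
  · simp [F, hφ]
  · simp [F, hφ]

end Consistency

section Maximality

variable {W : Set SignedMF} {Ts : List (Set SignedMF)}

theorem exists_deriv_add_of_not_mem (hW : Maximal (fun W => Consistent (W :: Ts)) W)
    {x : SignedMF} (hx : x ∉ W) :
    ∃ (S : Seqt) (R : Hyperseq), S.Within W ∧ List.Forall₂ Seqt.Within R Ts ∧
      Deriv cfRT (S.add x :: R) := by
  have hn : ¬ Consistent (insert x W :: Ts) := fun hc =>
    hx (hW.2 hc (Set.subset_insert x W) (Set.mem_insert x W))
  simp only [Consistent, not_forall, not_not] at hn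
  obtain ⟨_, _ | @⟨S, _, R, _, hS, hR⟩, hd⟩ := hn
  obtain ⟨S', hS', hi⟩ := hS.exists_add
  exact ⟨S', R, hS', hR, hd.incl (G := []) hi⟩

theorem mem_of_unary_rule (hW : Maximal (fun W => Consistent (W :: Ts)) W) {x y : SignedMF}
    (hrule : ∀ (S : Seqt) (R : Hyperseq), Deriv cfRT (S.add x :: R) → Deriv cfRT (S.add y :: R))
    (hy : y ∈ W) : x ∈ W := by
  by_contra hx
  obtain ⟨S, R, hS, hR, hd⟩ := exists_deriv_add_of_not_mem hW hx
  exact hW.1 _ (.cons (hS.add hy) hR) (hrule S R hd)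

theorem mem_of_binary_rule (hW : Maximal (fun W => Consistent (W :: Ts)) W) {x x' y : SignedMF}
    (hrule : ∀ (S : Seqt) (R : Hyperseq), Deriv cfRT (S.add x :: R) →
      Deriv cfRT (S.add x' :: R) → Deriv cfRT (S.add y :: R))
    (hy : y ∈ W) : x ∈ W ∨ x' ∈ W := by
  by_contra! hx
  obtain ⟨S, R, hS, hR, hd⟩ := exists_deriv_add_of_not_mem hW hx.1
  obtain ⟨S', R', hS', hR', hd'⟩ := exists_deriv_add_of_not_mem hW hx.2
  obtain ⟨_, _ | ⟨hQ, hQs⟩, _ | ⟨h1, h2⟩, _ | ⟨h3, h4⟩⟩ :=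
    exists_common_extension (.cons hS hR) (.cons hS' hR')
  exact hW.1 _ (.cons (hQ.add hy) hQs) (hrule _ _
    (.forall₂_incl (G := []) (.cons (h1.add x) h2) hd)
    (.forall₂_incl (G := []) (.cons (h3.add x') h4) hd'))

end Maximality

/-- The conditions a set of signed formulas satisfies to be a world of the canonical model. -/
structure IsWorld (W : Set SignedMF) : Prop where
  consistent : Consistent [W]
  neg_true : ∀ φ, (true, .neg φ) ∈ W → (false, φ) ∈ W
  neg_false : ∀ φ, (false, .neg φ) ∈ W → (true, φ) ∈ W
  conj_true : ∀ φ ψ, (true, .conj φ ψ) ∈ W → (true, φ) ∈ W ∧ (true, ψ) ∈ W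
  conj_false : ∀ φ ψ, (false, .conj φ ψ) ∈ W → (false, φ) ∈ W ∨ (false, ψ) ∈ W
  box_true : ∀ φ, (true, .box φ) ∈ W → (true, φ) ∈ W

theorem isWorld_of_maximal {W : Set SignedMF} {Ts : List (Set SignedMF)}
    (hW : Maximal (fun W => Consistent (W :: Ts)) W) : IsWorld W where
  consistent := hW.1.head
  neg_true _ := mem_of_unary_rule hW fun _ _ => .negL [] _ _ _ _
  neg_false _ := mem_of_unary_rule hW fun _ _ => .negR [] _ _ _ _
  conj_true _ _ h := ⟨mem_of_unary_rule hW (fun _ _ => .andL1 [] _ _ _ _ _) h,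
    mem_of_unary_rule hW (fun _ _ => .andL2 [] _ _ _ _ _) h⟩
  conj_false _ _ := mem_of_binary_rule hW fun _ _ => .andR [] _ _ _ _ _
  box_true _ := mem_of_unary_rule hW fun _ _ => .reflexivity rfl

/-- The canonical model of cut-free RT. -/
def canonicalModel : KModel where
  W := {W : Set SignedMF // IsWorld W}
  R w v := boxed w.1 ⊆ v.1
  V n w := (true, .atom n) ∈ w.1

theorem canonicalModel_reflexive : Reflexive canonicalModel.R := by
  rintro ⟨W, hW⟩ ⟨_, φ⟩ ⟨rfl, h⟩
  exact hW.box_true φ h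

theorem Consistent.exists_branch {T : Set SignedMF} {Ts : List (Set SignedMF)}
    (h : Consistent (T :: Ts)) :
    ∃ (w : canonicalModel.W) (ws : List canonicalModel.W), T ⊆ w.1 ∧
      List.Forall₂ (fun T v => T ⊆ v.1) Ts ws ∧ List.IsChain canonicalModel.R (w :: ws) := by
  induction Ts generalizing T with
  | nil =>
    obtain ⟨W, hTW, hW⟩ := h.exists_maximal
    exact ⟨⟨W, isWorld_of_maximal hW⟩, [], hTW, .nil, .singleton _⟩
  | cons U Ts ih =>
    obtain ⟨W, hTW, hW⟩ := h.exists_maximal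
    obtain ⟨v, vs, hv, hvs, hc⟩ := ih hW.1.union_boxed.tail
    obtain ⟨hUv, hWv⟩ := Set.union_subset_iff.1 hv
    exact ⟨⟨W, isWorld_of_maximal hW⟩, v :: vs, hTW, .cons hUv hvs, .cons_cons hWv hc⟩

theorem canonicalModel_truth (φ : MF) (w : canonicalModel.W) :
    ((true, φ) ∈ w.1 → canonicalModel.sat w φ) ∧
      ((false, φ) ∈ w.1 → ¬ canonicalModel.sat w φ) := by
  induction φ generalizing w with
  | atom n =>
    refine ⟨id, fun hf ht => w.2.consistent _ (.cons ?_ .nil) (.ax (.atom n))⟩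
    simp only [Seqt.Within, Multiset.mem_singleton, forall_eq]
    exact ⟨ht, hf⟩
  | neg φ ih =>
    exact ⟨fun h => (ih w).2 (w.2.neg_true φ h), fun h hs => hs ((ih w).1 (w.2.neg_false φ h))⟩
  | conj φ ψ ihφ ihψ =>
    refine ⟨fun h => ?_, fun h hs => ?_⟩
    · have := w.2.conj_true φ ψ h
      exact ⟨(ihφ w).1 this.1, (ihψ w).1 this.2⟩
    · rcases w.2.conj_false φ ψ h with h | h
      · exact (ihφ w).2 h hs.1
      · exact (ihψ w).2 h hs.2
  | box φ ih =>
    refine ⟨fun h v hv => (ih v).1 (hv ⟨rfl, h⟩), fun h hs => ?_⟩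
    obtain ⟨v, -, hv, -⟩ := (w.2.consistent.boxR h).union_boxed.tail.exists_branch
    obtain ⟨hφ, hwv⟩ := Set.union_subset_iff.1 hv
    exact (ih v).2 (hφ rfl) (hs v hwv)

/-- The signed formulas of a finite sequent. -/
def Seqt.toSet (S : Seqt) : Set SignedMF :=
  {x | (x.1 = true ∧ x.2 ∈ S.ant) ∨ (x.1 = false ∧ x.2 ∈ S.suc)}

theorem Seqt.Within.incl {S S' : Seqt} (h : S.Within S'.toSet) : S.Incl S' :=
  ⟨fun φ hφ => by simpa [Seqt.toSet] using h.1 φ hφ,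
    fun φ hφ => by simpa [Seqt.toSet] using h.2 φ hφ⟩

theorem consistent_of_not_deriv {H : Hyperseq} (h : ¬ Deriv cfRT H) :
    Consistent (H.map Seqt.toSet) := fun _ hL hd =>
  h (.forall₂_incl (G := []) ((List.forall₂_map_right_iff.1 hL).imp fun _ _ => Seqt.Within.incl) hd)

theorem countermodel_of_toSet_subset {S : Seqt} {w : canonicalModel.W} (h : S.toSet ⊆ w.1) :
    Countermodel canonicalModel w S :=
  ⟨fun φ hφ => (canonicalModel_truth φ w).1 (h (.inl ⟨rfl, hφ⟩)),
    fun φ hφ => (canonicalModel_truth φ w).2 (h (.inr ⟨rfl, hφ⟩))⟩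

/-- Cut-free completeness of RT: every hypersequent not provable in cut-free RT
has a counter-example whose accessibility relation is reflexive (equivalently,
every hypersequent valid over the class of reflexive frames is provable in RT
without cut). -/
theorem cut_free_completeness_RT (H : Hyperseq) (hne : H ≠ [])
    (h : ¬ Deriv cfRT H) :
    ∃ M : KModel, Reflexive M.R ∧ CounterExample M H := by
  obtain _ | ⟨S, H⟩ := H
  · exact absurd rfl hne
  obtain ⟨w, ws, hw, hws, hc⟩ := (consistent_of_not_deriv h).exists_branch
  exact ⟨canonicalModel, canonicalModel_reflexive, w :: ws, hc,
    .cons (countermodel_of_toSet_subset hw)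
      ((List.forall₂_map_left_iff.1 hws).imp fun _ _ => countermodel_of_toSet_subset)⟩
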